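/- (Pathwise Itô formula, one-dimensional with FV parameters) Let X : [0,∞) → ℝ be continuous with continuous quadratic variation [X] along grids (T_N), let A : [0,∞) → ℝⁿ be continuous with components locally of finite variation, and let f ∈ C^{1,2}(ℝⁿ × ℝ). Then for all t > 0, the Riemann sums ∑_{t_i, t_{i+1} ∈ T_N, t_{i+1} ≤ t} f_x(A_{t_i}, X_{t_i})(X_{t_{i+1}} − X_{t_i}) converge as N → ∞, and f(A_t, X_t) − f(A_0, X_0) = ∑_{k=1}^n ∫_0^t f_{a^k}(A_s, X_s) dA_s^k + ∫_0^t f_x(A_s, X_s) dX_s + (1/2)∫_0^t f_{xx}(A_s, X_s) d[X]_s, where the first and last integrals are Riemann–Stieltjes integrals. -/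

import Mathlib

open Filter Topology Set MeasureTheory

/-- A refining sequence of time grids: each grid is a strictly increasing
sequence starting at 0 and tending to infinity; grids are nested and the
mesh tends to zero. -/
structure GridSeq where
  T : ℕ → ℕ → ℝ
  zero : ∀ N, T N 0 = 0
  mono : ∀ N, StrictMono (T N)
  unbounded : ∀ N, Filter.Tendsto (T N) Filter.atTop Filter.atTop
  nested : ∀ N, Set.range (T N) ⊆ Set.range (T (N + 1))
  mesh : ∀ ε > 0, ∃ N₀, ∀ N ≥ N₀, ∀ i, T N (i + 1) - T N i ≤ ε

/-- The grid sum `∑_{t_i, t_{i+1} ∈ τ, t_{i+1} ≤ t} f(t_i, t_{i+1})`. -/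
noncomputable def gridSum (τ : ℕ → ℝ) (f : ℝ → ℝ → ℝ) (t : ℝ) : ℝ :=
  ∑' i : ℕ, if τ (i + 1) ≤ t then f (τ i) (τ (i + 1)) else 0

/-- The grid sums of `f` along the grid sequence `G` converge to `L` at time `t`. -/
def ConvTo (G : GridSeq) (f : ℝ → ℝ → ℝ) (t L : ℝ) : Prop :=
  Filter.Tendsto (fun N => gridSum (G.T N) f t) Filter.atTop (nhds L)

/-- `X` has continuous quadratic variation `Q` along the grid sequence `G`. -/
def HasQV (G : GridSeq) (X Q : ℝ → ℝ) : Prop :=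
  ContinuousOn Q (Set.Ici 0) ∧ Q 0 = 0 ∧
    ∀ t, ConvTo G (fun u v => (X v - X u) ^ 2) t (Q t)

/-- `A` is locally of finite variation on `[0,∞)`. -/
def LocBV (A : ℝ → ℝ) : Prop := ∀ T > 0, BoundedVariationOn A (Set.Icc 0 T)

/-- `ξ` is an admissible integrand for `X`: locally `ξ_t = g(A_t, X_t)` with
`g ∈ C¹` and `A` continuous of finite variation. -/
def Admissible (X ξ : ℝ → ℝ) : Prop :=
  ∀ T > 0, ∃ (n : ℕ) (g : (Fin n → ℝ) → ℝ → ℝ) (A : ℝ → Fin n → ℝ),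
    ContDiff ℝ 1 (Function.uncurry g) ∧
    (∀ k, ContinuousOn (fun t => A t k) (Set.Icc 0 T) ∧
      BoundedVariationOn (fun t => A t k) (Set.Icc 0 T)) ∧
    ∀ t ∈ Set.Icc (0 : ℝ) T, ξ t = g (A t) (X t)

namespace GridSeq

lemma exists_lt_T (G : GridSeq) (N : ℕ) (t : ℝ) : ∃ i, t < G.T N (i + 1) :=
  (((G.unbounded N).comp (tendsto_add_atTop_nat 1)).eventually_gt_atTop t).exists

open Classical in
/-- The number of intervals of the `N`-th grid that lie to the left of `t`. -/
noncomputable def count (G : GridSeq) (N : ℕ) (t : ℝ) : ℕ :=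
  Nat.find (G.exists_lt_T N t)

lemma T_succ_le_iff (G : GridSeq) (N : ℕ) (t : ℝ) (i : ℕ) :
    G.T N (i + 1) ≤ t ↔ i < G.count N t := by
  classical
  constructor
  · intro h
    by_contra! hc
    have h1 : t < G.T N (G.count N t + 1) := Nat.find_spec (G.exists_lt_T N t)
    have h2 := (G.mono N).monotone (Nat.add_le_add_right hc 1)
    linarith
  · intro h
    exact not_lt.1 (Nat.find_min (G.exists_lt_T N t) h)

lemma lt_T_count_succ (G : GridSeq) (N : ℕ) (t : ℝ) : t < G.T N (G.count N t + 1) :=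
  not_le.1 fun h => lt_irrefl _ ((G.T_succ_le_iff N t _).1 h)

lemma T_nonneg (G : GridSeq) (N i : ℕ) : 0 ≤ G.T N i := by
  rw [← G.zero N]
  exact (G.mono N).monotone (Nat.zero_le i)

lemma T_mem_Icc (G : GridSeq) {t : ℝ} (ht : 0 ≤ t) {N i : ℕ} (hi : i ≤ G.count N t) :
    G.T N i ∈ Icc 0 t := by
  refine ⟨G.T_nonneg N i, ?_⟩
  cases i with
  | zero => rwa [G.zero]
  | succ i => exact (G.T_succ_le_iff N t i).2 hi

lemma tendsto_T_count (G : GridSeq) {t : ℝ} (ht : 0 ≤ t) :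
    Tendsto (fun N => G.T N (G.count N t)) atTop (𝓝 t) := by
  rw [Metric.tendsto_atTop]
  intro ε hε
  obtain ⟨N₀, hN₀⟩ := G.mesh (ε / 2) (by positivity)
  refine ⟨N₀, fun N hN => ?_⟩
  have h1 := hN₀ N hN (G.count N t)
  have h2 := G.lt_T_count_succ N t
  have h3 := (G.T_mem_Icc ht (le_refl (G.count N t))).2
  rw [Real.dist_eq, abs_lt]
  constructor <;> linarith

lemma gridSum_eq (G : GridSeq) (N : ℕ) (f : ℝ → ℝ → ℝ) (t : ℝ) :
    gridSum (G.T N) f t =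
      ∑ i ∈ Finset.range (G.count N t), f (G.T N i) (G.T N (i + 1)) := by
  unfold gridSum
  rw [tsum_eq_sum (s := Finset.range (G.count N t))]
  · refine Finset.sum_congr rfl fun i hi => if_pos ?_
    exact (G.T_succ_le_iff N t i).2 (Finset.mem_range.1 hi)
  · intro i hi
    refine if_neg fun h => hi (Finset.mem_range.2 ((G.T_succ_le_iff N t i).1 h))

lemma gridSum_add (G : GridSeq) (N : ℕ) (f g : ℝ → ℝ → ℝ) (t : ℝ) :
    gridSum (G.T N) (fun u v => f u v + g u v) t =
      gridSum (G.T N) f t + gridSum (G.T N) g t := by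
  simp only [gridSum_eq, Finset.sum_add_distrib]

lemma gridSum_sub (G : GridSeq) (N : ℕ) (f g : ℝ → ℝ → ℝ) (t : ℝ) :
    gridSum (G.T N) (fun u v => f u v - g u v) t =
      gridSum (G.T N) f t - gridSum (G.T N) g t := by
  simp only [gridSum_eq, Finset.sum_sub_distrib]

lemma gridSum_const_mul (G : GridSeq) (N : ℕ) (c : ℝ) (f : ℝ → ℝ → ℝ) (t : ℝ) :
    gridSum (G.T N) (fun u v => c * f u v) t = c * gridSum (G.T N) f t := by
  simp only [gridSum_eq, Finset.mul_sum]

lemma gridSum_sum (G : GridSeq) (N : ℕ) {ι : Type*} (s : Finset ι) (f : ι → ℝ → ℝ → ℝ) (t : ℝ) :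
    gridSum (G.T N) (fun u v => ∑ k ∈ s, f k u v) t = ∑ k ∈ s, gridSum (G.T N) (f k) t := by
  simp only [gridSum_eq]
  exact Finset.sum_comm

lemma gridSum_increment (G : GridSeq) (N : ℕ) (F : ℝ → ℝ) (t : ℝ) :
    gridSum (G.T N) (fun u v => F v - F u) t = F (G.T N (G.count N t)) - F 0 := by
  rw [gridSum_eq, Finset.sum_range_sub (fun i => F (G.T N i)), G.zero]

lemma gridSum_indicator (G : GridSeq) (N : ℕ) (f : ℝ → ℝ → ℝ) {s t : ℝ} (hst : s ≤ t) :
    gridSum (G.T N) (fun u v => (Iic s).indicator 1 v * f u v) t = gridSum (G.T N) f s := by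
  unfold gridSum
  congr 1
  ext i
  by_cases h : G.T N (i + 1) ≤ s
  · simp [h, h.trans hst]
  · simp [h]

lemma gridSum_mono_time (G : GridSeq) (N : ℕ) {f : ℝ → ℝ → ℝ} (hf : ∀ u v, 0 ≤ f u v)
    {s t : ℝ} (hst : s ≤ t) : gridSum (G.T N) f s ≤ gridSum (G.T N) f t := by
  rw [← G.gridSum_indicator N f hst, gridSum_eq, gridSum_eq]
  refine Finset.sum_le_sum fun i _ => mul_le_of_le_one_left (hf _ _) ?_
  exact indicator_le_self' (by simp) _

lemma eventually_abs_gridSum_le (G : GridSeq) {r H : ℝ → ℝ → ℝ} {t ε δ C : ℝ} (ht : 0 ≤ t)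
    (hε : 0 ≤ ε) (hδ : 0 < δ)
    (hr : ∀ u ∈ Icc 0 t, ∀ v ∈ Icc 0 t, |v - u| < δ → |r u v| ≤ ε * H u v)
    (hC : ∀ᶠ N in atTop, gridSum (G.T N) H t ≤ C) :
    ∀ᶠ N in atTop, |gridSum (G.T N) r t| ≤ ε * C := by
  obtain ⟨N₀, hN₀⟩ := G.mesh (δ / 2) (by positivity)
  filter_upwards [hC, eventually_ge_atTop N₀] with N hN hNN
  refine le_trans ?_ (mul_le_mul_of_nonneg_left hN hε)
  rw [gridSum_eq, gridSum_eq, Finset.mul_sum]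
  refine (Finset.abs_sum_le_sum_abs _ _).trans (Finset.sum_le_sum fun i hi => ?_)
  have hi := Finset.mem_range.1 hi
  refine hr _ (G.T_mem_Icc ht hi.le) _ (G.T_mem_Icc ht hi) ?_
  have h1 := hN₀ N hNN i
  have h2 := G.mono N (Nat.lt_succ_self i)
  rw [abs_lt]
  constructor <;> linarith

end GridSeq

lemma convTo_increment (G : GridSeq) {F : ℝ → ℝ} (hF : ContinuousOn F (Ici 0)) {t : ℝ}
    (ht : 0 ≤ t) : ConvTo G (fun u v => F v - F u) t (F t - F 0) := by
  unfold ConvTo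
  simp only [G.gridSum_increment]
  refine Tendsto.sub_const ?_ _
  refine (hF t ht).tendsto.comp (tendsto_nhdsWithin_iff.2 ⟨G.tendsto_T_count ht, ?_⟩)
  exact Eventually.of_forall fun N => G.T_nonneg N _

/-- A remainder that is uniformly negligible with respect to increments with bounded grid sums
has vanishing grid sums. -/
lemma convTo_zero_of_isLittle (G : GridSeq) {r H : ℝ → ℝ → ℝ} {t C : ℝ} (ht : 0 ≤ t)
    (hC : ∀ᶠ N in atTop, gridSum (G.T N) H t ≤ C)
    (hr : ∀ ε > 0, ∃ δ > 0, ∀ u ∈ Icc 0 t, ∀ v ∈ Icc 0 t, |v - u| < δ → |r u v| ≤ ε * H u v) :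
    ConvTo G r t 0 := by
  unfold ConvTo
  rw [Metric.tendsto_nhds]
  intro ε hε
  obtain ⟨δ, hδ, h⟩ := hr (ε / (|C| + 1)) (by positivity)
  filter_upwards [G.eventually_abs_gridSum_le ht (by positivity) hδ h hC] with N hN
  rw [dist_zero_right, Real.norm_eq_abs]
  refine hN.trans_lt ?_
  rw [div_mul_eq_mul_div, div_lt_iff₀ (by positivity)]
  exact mul_lt_mul_of_pos_left ((le_abs_self C).trans_lt (lt_add_one _)) hε

lemma exists_step_approx {g : ℝ → ℝ} {t : ℝ} (ht : 0 ≤ t) (hg : ContinuousOn g (Icc 0 t)) {ε : ℝ}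
    (hε : 0 < ε) :
    ∃ φ ∈ Submodule.span ℝ ((fun s => (Iic s).indicator (1 : ℝ → ℝ)) '' Icc 0 t),
      ∀ v ∈ Icc 0 t, |g v - φ v| ≤ ε := by
  obtain ⟨δ, hδ, h⟩ := Metric.uniformContinuousOn_iff.1
    (isCompact_Icc.uniformContinuousOn_of_continuous hg) ε hε
  set d := δ / 2 with hd
  have hd0 : 0 < d := by positivity
  set S := Submodule.span ℝ ((fun s => (Iic s).indicator (1 : ℝ → ℝ)) '' Icc 0 t)
  have key : ∀ k : ℕ, ∃ φ ∈ S, (∀ v, min (k * d) t < v → φ v = 0) ∧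
      ∀ v ∈ Icc 0 (min (k * d) t), |g v - φ v| ≤ ε := by
    intro k
    induction k with
    | zero =>
      refine ⟨g 0 • (Iic (0 : ℝ)).indicator 1,
        S.smul_mem _ (Submodule.subset_span ⟨0, ⟨le_rfl, ht⟩, rfl⟩), ?_, ?_⟩
      · intro v hv
        have hv : 0 < v := by simpa [ht] using hv
        simp [hv]
      · intro v hv
        have hv : v = 0 := by
          have h2 := hv.2
          simp only [Nat.cast_zero, zero_mul, min_eq_left ht] at h2
          exact le_antisymm h2 hv.1
        simp [hv, hε.le]
    | succ k ih =>
      obtain ⟨φ, hφ, h0, h1⟩ := ih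
      have hs0 : 0 ≤ min (k * d) t := le_min (by positivity) ht
      have hss : min (k * d) t ≤ min ((k + 1 : ℕ) * d) t := by
        gcongr
        simp
      have hsd : min ((k + 1 : ℕ) * d) t ≤ min (k * d) t + d := by
        push_cast
        rw [← min_add_add_right, add_mul, one_mul]
        gcongr
        linarith
      have hst := min_le_right ((k + 1 : ℕ) * d) t
      set s := min (k * d) t
      set s' := min ((k + 1 : ℕ) * d) t
      refine ⟨φ + g s' • ((Iic s').indicator 1 - (Iic s).indicator 1), ?_, ?_, ?_⟩
      · refine S.add_mem hφ (S.smul_mem _ (S.sub_mem ?_ ?_))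
        · exact Submodule.subset_span ⟨s', ⟨hs0.trans hss, hst⟩, rfl⟩
        · exact Submodule.subset_span ⟨s, ⟨hs0, hss.trans hst⟩, rfl⟩
      · intro v hv
        simp [h0 v (hss.trans_lt hv), hv, hss.trans_lt hv]
      · intro v hv
        rcases le_or_gt v s with hvs | hvs
        · simpa [hvs, hvs.trans hss] using h1 v ⟨hv.1, hvs⟩
        · have h2 := h v ⟨hv.1, hv.2.trans hst⟩ s' ⟨hs0.trans hss, hst⟩ (by
            rw [Real.dist_eq, abs_lt]
            constructor <;> linarith [hv.2])
          rw [Real.dist_eq] at h2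
          simpa [h0 v hvs, hv.2, hvs] using h2.le
  obtain ⟨k, hk⟩ := exists_nat_ge (t / d)
  obtain ⟨φ, hφ, -, h1⟩ := key k
  rw [min_eq_right ((div_le_iff₀ hd0).1 hk)] at h1
  exact ⟨φ, hφ, h1⟩

lemma exists_step_gridSum_approx (G : GridSeq) {h : ℝ → ℝ → ℝ} {g : ℝ → ℝ} {t C : ℝ} (ht : 0 ≤ t)
    (hC : ∀ᶠ N in atTop, gridSum (G.T N) (fun u v => |h u v|) t ≤ C)
    (hg : ContinuousOn g (Icc 0 t)) {ε : ℝ} (hε : 0 < ε) :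
    ∃ φ ∈ Submodule.span ℝ ((fun s => (Iic s).indicator (1 : ℝ → ℝ)) '' Icc 0 t),
      ∀ᶠ N in atTop, |gridSum (G.T N) (fun u v => g u * h u v) t -
        gridSum (G.T N) (fun u v => φ v * h u v) t| ≤ ε := by
  have hη : 0 < ε / (|C| + 1) / 2 := by positivity
  obtain ⟨φ, hφ, happ⟩ := exists_step_approx ht hg hη
  obtain ⟨δ, hδ, huc⟩ := Metric.uniformContinuousOn_iff.1
    (isCompact_Icc.uniformContinuousOn_of_continuous hg) _ hη
  refine ⟨φ, hφ, ?_⟩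
  have hr : ∀ u ∈ Icc 0 t, ∀ v ∈ Icc 0 t, |v - u| < δ →
      |g u * h u v - φ v * h u v| ≤ ε / (|C| + 1) * |h u v| := by
    intro u hu v hv huv
    rw [← sub_mul, abs_mul]
    gcongr
    have h1 := huc u hu v hv (by rwa [dist_comm, Real.dist_eq])
    rw [Real.dist_eq] at h1
    have h2 := happ v hv
    calc |g u - φ v| = |(g u - g v) + (g v - φ v)| := by ring_nf
      _ ≤ |g u - g v| + |g v - φ v| := abs_add_le _ _
      _ ≤ ε / (|C| + 1) := by linarith
  filter_upwards [G.eventually_abs_gridSum_le ht (by positivity) hδ hr hC] with N hN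
  rw [← G.gridSum_sub]
  refine hN.trans ?_
  rw [div_mul_eq_mul_div, div_le_iff₀ (by positivity)]
  exact mul_le_mul_of_nonneg_left ((le_abs_self C).trans (lt_add_one _).le) hε.le

lemma convTo_step (G : GridSeq) {h : ℝ → ℝ → ℝ} {Q : ℝ → ℝ} {t : ℝ}
    (hh : ∀ s ∈ Icc 0 t, ConvTo G h s (Q s)) {φ : ℝ → ℝ}
    (hφ : φ ∈ Submodule.span ℝ ((fun s => (Iic s).indicator (1 : ℝ → ℝ)) '' Icc 0 t)) :
    ∃ L, ConvTo G (fun u v => φ v * h u v) t L ∧ (Q = 0 → L = 0) := by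
  induction hφ using Submodule.span_induction with
  | mem x hx =>
    obtain ⟨s, hs, rfl⟩ := hx
    refine ⟨Q s, ?_, fun hQ => by simp [hQ]⟩
    unfold ConvTo
    simp only [G.gridSum_indicator _ h hs.2]
    exact hh s hs
  | zero => exact ⟨0, by simp [ConvTo, gridSum], fun _ => rfl⟩
  | add x y _ _ hx hy =>
    obtain ⟨a, ha, ha0⟩ := hx
    obtain ⟨b, hb, hb0⟩ := hy
    refine ⟨a + b, ?_, fun hQ => by simp [ha0 hQ, hb0 hQ]⟩
    unfold ConvTo
    simp only [Pi.add_apply, add_mul, G.gridSum_add]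
    exact Tendsto.add ha hb
  | smul c x _ hx =>
    obtain ⟨a, ha, ha0⟩ := hx
    refine ⟨c * a, ?_, fun hQ => by simp [ha0 hQ]⟩
    unfold ConvTo
    simp only [Pi.smul_apply, smul_eq_mul, mul_assoc, G.gridSum_const_mul]
    exact Tendsto.const_mul c ha

/-- Grid sums of a continuous integrand against increments of bounded variation whose
grid sums converge are themselves convergent. -/
lemma exists_convTo_mul (G : GridSeq) {h : ℝ → ℝ → ℝ} {Q g : ℝ → ℝ} {t C : ℝ} (ht : 0 ≤ t)
    (hC : ∀ᶠ N in atTop, gridSum (G.T N) (fun u v => |h u v|) t ≤ C)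
    (hh : ∀ s ∈ Icc 0 t, ConvTo G h s (Q s)) (hg : ContinuousOn g (Icc 0 t)) :
    ∃ L, ConvTo G (fun u v => g u * h u v) t L := by
  refine cauchySeq_tendsto_of_complete (Metric.cauchySeq_iff'.2 fun ε hε => ?_)
  obtain ⟨φ, hφ, happ⟩ := exists_step_gridSum_approx G ht hC hg (ε := ε / 4) (by positivity)
  obtain ⟨L, hL, -⟩ := convTo_step G hh hφ
  have hnear := Metric.tendsto_nhds.1 hL (ε / 4) (by positivity)
  have hev : ∀ᶠ N in atTop, |gridSum (G.T N) (fun u v => g u * h u v) t - L| < ε / 2 := by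
    filter_upwards [happ, hnear] with N h1 h2
    rw [Real.dist_eq] at h2
    rw [abs_le] at h1
    rw [abs_lt] at h2 ⊢
    constructor <;> linarith
  obtain ⟨N₀, hN₀⟩ := eventually_atTop.1 hev
  refine ⟨N₀, fun N hN => ?_⟩
  have h1 := abs_lt.1 (hN₀ N hN)
  have h2 := abs_lt.1 (hN₀ N₀ le_rfl)
  rw [Real.dist_eq, abs_lt]
  constructor <;> linarith

lemma convTo_mul_zero (G : GridSeq) {h : ℝ → ℝ → ℝ} {g : ℝ → ℝ} {t C : ℝ} (ht : 0 ≤ t)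
    (hC : ∀ᶠ N in atTop, gridSum (G.T N) (fun u v => |h u v|) t ≤ C)
    (hh : ∀ s ∈ Icc 0 t, ConvTo G h s 0) (hg : ContinuousOn g (Icc 0 t)) :
    ConvTo G (fun u v => g u * h u v) t 0 := by
  refine Metric.tendsto_nhds.2 fun ε hε => ?_
  obtain ⟨φ, hφ, happ⟩ := exists_step_gridSum_approx G ht hC hg (ε := ε / 4) (by positivity)
  obtain ⟨L, hL, hL0⟩ := convTo_step G (Q := 0) hh hφ
  rw [hL0 rfl] at hL
  filter_upwards [happ, Metric.tendsto_nhds.1 hL (ε / 4) (by positivity)] with N h1 h2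
  rw [Real.dist_eq] at h2 ⊢
  rw [abs_le] at h1
  rw [abs_lt] at h2 ⊢
  constructor <;> linarith

namespace ConvTo

variable {G : GridSeq} {f g : ℝ → ℝ → ℝ} {t a b : ℝ}

lemma add (hf : ConvTo G f t a) (hg : ConvTo G g t b) :
    ConvTo G (fun u v => f u v + g u v) t (a + b) := by
  unfold ConvTo
  simp only [G.gridSum_add]
  exact Tendsto.add hf hg

lemma sub (hf : ConvTo G f t a) (hg : ConvTo G g t b) :
    ConvTo G (fun u v => f u v - g u v) t (a - b) := by
  unfold ConvTo
  simp only [G.gridSum_sub]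
  exact Tendsto.sub hf hg

lemma const_mul (c : ℝ) (hf : ConvTo G f t a) :
    ConvTo G (fun u v => c * f u v) t (c * a) := by
  unfold ConvTo
  simp only [G.gridSum_const_mul]
  exact Tendsto.const_mul c hf

lemma sum {ι : Type*} (s : Finset ι) {F : ι → ℝ → ℝ → ℝ} {L : ι → ℝ}
    (hF : ∀ k, ConvTo G (F k) t (L k)) :
    ConvTo G (fun u v => ∑ k ∈ s, F k u v) t (∑ k ∈ s, L k) := by
  unfold ConvTo
  simp only [G.gridSum_sum]
  exact tendsto_finsetSum s fun k _ => hF k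

lemma eventually_le (hf : ConvTo G f t a) : ∀ᶠ N in atTop, gridSum (G.T N) f t ≤ a + 1 :=
  Tendsto.eventually_le_const (lt_add_one a) hf

end ConvTo

lemma HasQV.monotone {G : GridSeq} {X Q : ℝ → ℝ} (hQ : HasQV G X Q) : Monotone Q :=
  fun s t hst => le_of_tendsto_of_tendsto' (hQ.2.2 s) (hQ.2.2 t) fun N =>
    G.gridSum_mono_time N (fun _ _ => sq_nonneg _) hst

lemma gridSum_abs_increment_le (G : GridSeq) {F : ℝ → ℝ} {t : ℝ} (ht : 0 ≤ t)
    (hF : BoundedVariationOn F (Icc 0 t)) (N : ℕ) :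
    gridSum (G.T N) (fun u v => |F v - F u|) t ≤ (eVariationOn F (Icc 0 t)).toReal := by
  rw [G.gridSum_eq]
  have h := eVariationOn.sum_le_of_monotoneOn_Iic (f := F) (s := Icc 0 t) (u := G.T N)
    (n := G.count N t) ((G.mono N).monotone.monotoneOn _) fun i hi => G.T_mem_Icc ht hi
  have h' := ENNReal.toReal_mono hF h
  rw [ENNReal.toReal_sum fun i _ => edist_ne_top _ _] at h'
  simpa only [← dist_edist, Real.dist_eq] using h'

lemma exists_fderiv_remainder_le {E : Type*} [NormedAddCommGroup E] [NormedSpace ℝ E]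
    [ProperSpace E] {F : E → ℝ} (hF : ContDiff ℝ 1 F) (R : ℝ) {ε : ℝ} (hε : 0 < ε) :
    ∃ δ > 0, ∀ z ∈ Metric.closedBall (0 : E) R, ∀ p ∈ Metric.closedBall (0 : E) R,
      ∀ q ∈ Metric.closedBall (0 : E) R, dist p z < δ → dist q z < δ →
        |F q - F p - fderiv ℝ F z (q - p)| ≤ ε * ‖q - p‖ := by
  obtain ⟨δ, hδ, h⟩ := Metric.uniformContinuousOn_iff.1
    ((isCompact_closedBall (0 : E) R).uniformContinuousOn_of_continuous
      (hF.continuous_fderiv one_ne_zero).continuousOn) ε hε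
  refine ⟨δ, hδ, fun z hz p hp q hq hpz hqz => ?_⟩
  refine Convex.norm_image_sub_le_of_norm_fderiv_le' (𝕜 := ℝ)
    (s := Metric.closedBall 0 R ∩ Metric.ball z δ)
    (fun x _ => hF.differentiable one_ne_zero x) (fun x hx => ?_)
    ((convex_closedBall _ _).inter (convex_ball _ _)) ⟨hp, hpz⟩ ⟨hq, hqz⟩
  rw [← dist_eq_norm]
  exact (h x hx.1 z hz hx.2).le

lemma taylor_two_remainder_le {φ : ℝ → ℝ} (hφ : ContDiff ℝ 2 φ) {x y ε : ℝ}
    (h : ∀ s ∈ uIcc x y, |deriv (deriv φ) s - deriv (deriv φ) x| ≤ ε) :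
    |φ y - φ x - deriv φ x * (y - x) - 1 / 2 * (deriv (deriv φ) x * (y - x) ^ 2)|
      ≤ ε * (y - x) ^ 2 := by
  have hε : 0 ≤ ε := (abs_nonneg _).trans (h x left_mem_uIcc)
  have hd : ∀ s, HasDerivAt φ (deriv φ s) s := fun s =>
    (hφ.differentiable two_ne_zero s).hasDerivAt
  have hd2 : ∀ s, HasDerivAt (deriv φ) (deriv (deriv φ) s) s := fun s =>
    (hφ.differentiable_deriv_two s).hasDerivAt
  have h1 : ∀ s ∈ uIcc x y, ‖deriv φ s - deriv φ x - deriv (deriv φ) x * (s - x)‖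
      ≤ ε * |y - x| := by
    intro s hs
    have := Convex.norm_image_sub_le_of_norm_hasDerivWithin_le (𝕜 := ℝ)
      (f := fun s => deriv φ s - deriv (deriv φ) x * (s - x))
      (f' := fun s => deriv (deriv φ) s - deriv (deriv φ) x) (s := uIcc x y) (x := x) (y := s)
      (C := ε) (fun r _ => by
        have := (hd2 r).sub (((hasDerivAt_id r).sub_const x).const_mul (deriv (deriv φ) x))
        exact (this.congr_deriv (by simp)).hasDerivWithinAt)
      h (convex_uIcc x y) left_mem_uIcc hs
    calc _ = ‖deriv φ s - deriv (deriv φ) x * (s - x) -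
            (deriv φ x - deriv (deriv φ) x * (x - x))‖ := by ring_nf
      _ ≤ ε * ‖s - x‖ := this
      _ ≤ ε * |y - x| := by
        gcongr
        exact abs_sub_left_of_mem_uIcc hs
  have h2 := Convex.norm_image_sub_le_of_norm_hasDerivWithin_le (𝕜 := ℝ)
      (f := fun s => φ s - deriv φ x * (s - x) - 1 / 2 * (deriv (deriv φ) x * (s - x) ^ 2))
      (f' := fun s => deriv φ s - deriv φ x - deriv (deriv φ) x * (s - x))
      (s := uIcc x y) (x := x) (y := y) (C := ε * |y - x|) (fun r _ => by
        have hr := (hasDerivAt_id r).sub_const x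
        have := ((hd r).sub (hr.const_mul (deriv φ x))).sub
          (((hr.pow 2).const_mul (deriv (deriv φ) x)).const_mul (1 / 2))
        refine (this.congr_deriv ?_).hasDerivWithinAt
        simp
        ring)
      h1 (convex_uIcc x y) left_mem_uIcc right_mem_uIcc
  calc _ = ‖φ y - deriv φ x * (y - x) - 1 / 2 * (deriv (deriv φ) x * (y - x) ^ 2) -
          (φ x - deriv φ x * (x - x) - 1 / 2 * (deriv (deriv φ) x * (x - x) ^ 2))‖ := by
        rw [Real.norm_eq_abs]
        ring_nf
    _ ≤ ε * |y - x| * ‖y - x‖ := h2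
    _ = ε * (y - x) ^ 2 := by
      rw [Real.norm_eq_abs, mul_assoc, abs_mul_abs_self, sq]

lemma deriv_update_eq_fderiv {n : ℕ} {f : (Fin n → ℝ) → ℝ → ℝ}
    (hf : ContDiff ℝ 1 (Function.uncurry f)) (a : Fin n → ℝ) (x : ℝ) (k : Fin n) :
    deriv (fun s => f (Function.update a k s) x) (a k) =
      fderiv ℝ (Function.uncurry f) (a, x) (Pi.single k 1, 0) := by
  have h1 : HasDerivAt (fun s => (Function.update a k s, x)) (Pi.single k (1 : ℝ), (0 : ℝ)) (a k) :=
    (hasDerivAt_update a k (a k)).prodMk (hasDerivAt_const _ _)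
  have h2 := (hf.differentiable one_ne_zero (a, x)).hasFDerivAt
  have h3 : HasFDerivAt (Function.uncurry f) (fderiv ℝ (Function.uncurry f) (a, x))
      (Function.update a k (a k), x) := by simpa using h2
  exact (h3.comp_hasDerivAt (a k) h1).deriv

lemma fderiv_uncurry_apply_inl {n : ℕ} {f : (Fin n → ℝ) → ℝ → ℝ}
    (hf : ContDiff ℝ 1 (Function.uncurry f)) (a : Fin n → ℝ) (x : ℝ) (w : Fin n → ℝ) :
    fderiv ℝ (Function.uncurry f) (a, x) (w, 0) =
      ∑ k, deriv (fun s => f (Function.update a k s) x) (a k) * w k := by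
  have hw : (w, (0 : ℝ)) = ∑ k, w k • ((Pi.single k 1 : Fin n → ℝ), (0 : ℝ)) := by
    ext k
    · simp [Prod.fst_sum, Finset.sum_apply, Pi.single_apply]
    · simp [Prod.snd_sum]
  rw [hw, map_sum]
  refine Finset.sum_congr rfl fun k _ => ?_
  rw [map_smul, deriv_update_eq_fderiv hf, smul_eq_mul, mul_comm]

lemma exists_norm_le_and_dist_lt {E : Type*} [NormedAddCommGroup E] {P : ℝ → E} {t : ℝ}
    (hP : ContinuousOn P (Icc 0 t)) :
    (∃ R, ∀ u ∈ Icc 0 t, ‖P u‖ ≤ R) ∧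
      ∀ η > 0, ∃ δ > 0, ∀ u ∈ Icc 0 t, ∀ v ∈ Icc 0 t, |v - u| < δ → dist (P v) (P u) < η := by
  refine ⟨isCompact_Icc.exists_bound_of_continuousOn hP, fun η hη => ?_⟩
  obtain ⟨δ, hδ, h⟩ := Metric.uniformContinuousOn_iff.1
    (isCompact_Icc.uniformContinuousOn_of_continuous hP) η hη
  exact ⟨δ, hδ, fun u hu v hv huv => h v hv u hu huv⟩

lemma convTo_parameter_remainder (G : GridSeq) {X : ℝ → ℝ} {n : ℕ} {A : ℝ → Fin n → ℝ}
    {f : (Fin n → ℝ) → ℝ → ℝ} {t : ℝ} (ht : 0 ≤ t) (hX : ContinuousOn X (Icc 0 t))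
    (hA : ContinuousOn A (Icc 0 t)) (hAV : ∀ k, BoundedVariationOn (fun s => A s k) (Icc 0 t))
    (hf : ContDiff ℝ 1 (Function.uncurry f)) :
    ConvTo G (fun u v => f (A v) (X v) - f (A u) (X v) -
      ∑ k, deriv (fun s => f (Function.update (A u) k s) (X u)) (A u k) * (A v k - A u k)) t 0 := by
  refine convTo_zero_of_isLittle G ht (H := fun u v => ∑ k, |A v k - A u k|)
    (C := ∑ k, (eVariationOn (fun s => A s k) (Icc 0 t)).toReal) ?_ ?_
  · refine Eventually.of_forall fun N => ?_
    rw [G.gridSum_sum N Finset.univ fun k u v => |A v k - A u k|]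
    exact Finset.sum_le_sum fun k _ => gridSum_abs_increment_le G ht (hAV k) N
  · intro ε hε
    obtain ⟨⟨R, hR⟩, hP⟩ := exists_norm_le_and_dist_lt (hA.prodMk hX)
    obtain ⟨η, hη, hrem⟩ := exists_fderiv_remainder_le hf R hε
    obtain ⟨δ, hδ, hP⟩ := hP η hη
    refine ⟨δ, hδ, fun u hu v hv huv => ?_⟩
    have hu' := hR u hu
    have hv' := hR v hv
    have huv' := hP u hu v hv huv
    have hX' : dist (X v) (X u) < η := (le_max_right _ _).trans_lt huv'
    have key := hrem (A u, X u) (mem_closedBall_zero_iff.2 hu') (A u, X v)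
      (mem_closedBall_zero_iff.2 (norm_prod_le_iff.2
        ⟨(norm_prod_le_iff.1 hu').1, (norm_prod_le_iff.1 hv').2⟩))
      (A v, X v) (mem_closedBall_zero_iff.2 hv') (by simpa [Prod.dist_eq, hη] using hX') huv'
    rw [Prod.mk_sub_mk, sub_self, fderiv_uncurry_apply_inl hf] at key
    refine key.trans (mul_le_mul_of_nonneg_left ?_ hε.le)
    have hs : 0 ≤ ∑ k, |A v k - A u k| := Finset.sum_nonneg fun k _ => abs_nonneg _
    refine norm_prod_le_iff.2 ⟨(pi_norm_le_iff_of_nonneg hs).2 fun k => ?_, by simpa using hs⟩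
    exact Finset.single_le_sum (f := fun k => |A v k - A u k|) (fun k _ => abs_nonneg _)
      (Finset.mem_univ k)

lemma convTo_taylor_remainder {G : GridSeq} {X Q : ℝ → ℝ} {n : ℕ} {A : ℝ → Fin n → ℝ}
    {f : (Fin n → ℝ) → ℝ → ℝ} {t : ℝ} (ht : 0 ≤ t) (hX : ContinuousOn X (Icc 0 t))
    (hQ : HasQV G X Q) (hA : ContinuousOn A (Icc 0 t)) (hf2 : ∀ a, ContDiff ℝ 2 (f a))
    (hf2c : Continuous fun p : (Fin n → ℝ) × ℝ => deriv (deriv (f p.1)) p.2) :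
    ConvTo G (fun u v => f (A u) (X v) - f (A u) (X u) - deriv (f (A u)) (X u) * (X v - X u) -
      1 / 2 * (deriv (deriv (f (A u))) (X u) * (X v - X u) ^ 2)) t 0 := by
  refine convTo_zero_of_isLittle G ht (hQ.2.2 t).eventually_le fun ε hε => ?_
  obtain ⟨⟨R, hR⟩, hP⟩ := exists_norm_le_and_dist_lt (hA.prodMk hX)
  obtain ⟨η, hη, huc⟩ := Metric.uniformContinuousOn_iff.1
    ((isCompact_closedBall (0 : (Fin n → ℝ) × ℝ) R).uniformContinuousOn_of_continuous
      hf2c.continuousOn) ε hε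
  obtain ⟨δ, hδ, hP⟩ := hP η hη
  refine ⟨δ, hδ, fun u hu v hv huv => taylor_two_remainder_le (hf2 _) fun s hs => ?_⟩
  have hu' := norm_prod_le_iff.1 (hR u hu)
  have hv' := norm_prod_le_iff.1 (hR v hv)
  have hX' : dist (X v) (X u) < η := (le_max_right _ _).trans_lt (hP u hu v hv huv)
  have hsX : |s - X u| < η := (abs_sub_left_of_mem_uIcc hs).trans_lt hX'
  have hsR : ‖s‖ ≤ R := mem_closedBall_zero_iff.1 <|
    (convex_closedBall (0 : ℝ) R).ordConnected.uIcc_subset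
      (mem_closedBall_zero_iff.2 hu'.2) (mem_closedBall_zero_iff.2 hv'.2) hs
  refine (huc (A u, s) (mem_closedBall_zero_iff.2 (norm_prod_le_iff.2 ⟨hu'.1, hsR⟩)) (A u, X u)
    (mem_closedBall_zero_iff.2 (hR u hu)) ?_).le
  simpa [Prod.dist_eq, Real.dist_eq, hη] using hsX

/-- Föllmer's pathwise Itô formula with finite-variation
parameters, in one dimension. All Stieltjes integrals are realized as limits
of the corresponding grid Riemann–Stieltjes sums. -/
theorem stmt6 (G : GridSeq) (X Q : ℝ → ℝ) (n : ℕ) (A : ℝ → Fin n → ℝ)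
    (f : (Fin n → ℝ) → ℝ → ℝ)
    (hX : ContinuousOn X (Set.Ici 0)) (hQ : HasQV G X Q)
    (hA : ∀ k, ContinuousOn (fun t => A t k) (Set.Ici 0) ∧ LocBV (fun t => A t k))
    (hf : ContDiff ℝ 1 (Function.uncurry f))
    (hf2 : ∀ a, ContDiff ℝ 2 (f a))
    (hf2c : Continuous fun p : (Fin n → ℝ) × ℝ => deriv (deriv (f p.1)) p.2) :
    ∀ t > 0, ∃ (I K : ℝ) (J : Fin n → ℝ),
      ConvTo G (fun u v => deriv (f (A u)) (X u) * (X v - X u)) t I ∧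
      (∀ k, ConvTo G
        (fun u v =>
          deriv (fun s => f (Function.update (A u) k s) (X u)) (A u k)
            * (A v k - A u k)) t (J k)) ∧
      ConvTo G (fun u v => deriv (deriv (f (A u))) (X u) * (Q v - Q u)) t K ∧
      f (A t) (X t) - f (A 0) (X 0) = (∑ k, J k) + I + K / 2 := by
  intro t ht
  have hsub : Icc 0 t ⊆ Ici 0 := Icc_subset_Ici_self
  have hAc : ContinuousOn A (Ici 0) := continuousOn_pi.2 fun k => (hA k).1
  have hP : ContinuousOn (fun s => (A s, X s)) (Ici 0) := hAc.prodMk hX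
  have hAV : ∀ k, BoundedVariationOn (fun s => A s k) (Icc 0 t) := fun k => (hA k).2 t ht
  have hYconv : ConvTo G (fun u v => f (A v) (X v) - f (A u) (X u)) t
      (f (A t) (X t) - f (A 0) (X 0)) :=
    convTo_increment G (hf.continuous.comp_continuousOn hP) ht.le
  have hJ : ∀ k, ∃ L, ConvTo G (fun u v =>
      deriv (fun s => f (Function.update (A u) k s) (X u)) (A u k) * (A v k - A u k)) t L := by
    intro k
    refine exists_convTo_mul G ht.le
      (Eventually.of_forall fun N => gridSum_abs_increment_le G ht.le (hAV k) N)
      (fun s hs => convTo_increment G (hA k).1 hs.1) ?_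
    simp only [deriv_update_eq_fderiv hf]
    exact ((hf.continuous_fderiv one_ne_zero).comp_continuousOn (hP.mono hsub)).clm_apply
      continuousOn_const
  choose J hJ using hJ
  have hc : ContinuousOn (fun u => deriv (deriv (f (A u))) (X u)) (Icc 0 t) :=
    hf2c.comp_continuousOn (hP.mono hsub)
  have hQinc : ∀ s ∈ Icc 0 t, ConvTo G (fun u v => Q v - Q u) s (Q s) := fun s hs => by
    simpa [hQ.2.1] using convTo_increment G hQ.1 hs.1
  have hQabs : ∀ᶠ N in atTop, gridSum (G.T N) (fun u v => |Q v - Q u|) t ≤ Q t + 1 := by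
    filter_upwards [(hQinc t ⟨ht.le, le_rfl⟩).eventually_le] with N hN
    rw [G.gridSum_eq] at hN ⊢
    refine le_of_eq_of_le (Finset.sum_congr rfl fun i _ => abs_of_nonneg ?_) hN
    exact sub_nonneg.2 (hQ.monotone ((G.mono N).monotone i.le_succ))
  obtain ⟨K, hK⟩ := exists_convTo_mul G ht.le hQabs hQinc hc
  have hdiff : ConvTo G (fun u v =>
      deriv (deriv (f (A u))) (X u) * ((X v - X u) ^ 2 - (Q v - Q u))) t 0 := by
    refine convTo_mul_zero G ht.le (C := (Q t + 1) + (Q t + 1)) ?_ (fun s hs => ?_) hc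
    · filter_upwards [(hQ.2.2 t).eventually_le, hQabs] with N h1 h2
      refine le_trans ?_ (add_le_add h1 h2)
      rw [← G.gridSum_add, G.gridSum_eq, G.gridSum_eq]
      refine Finset.sum_le_sum fun i _ => (abs_sub _ _).trans ?_
      rw [abs_of_nonneg (sq_nonneg _)]
    · simpa using (hQ.2.2 s).sub (hQinc s hs)
  have hA' := convTo_parameter_remainder G ht.le (hX.mono hsub) (hAc.mono hsub) hAV hf
  have hT := convTo_taylor_remainder ht.le (hX.mono hsub) hQ (hAc.mono hsub) hf2 hf2c
  refine ⟨f (A t) (X t) - f (A 0) (X 0) - 0 - 0 - (∑ k, J k) - 1 / 2 * (0 + K), K, J,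
    ?_, hJ, hK, by ring⟩
  convert (((hYconv.sub hA').sub hT).sub (ConvTo.sum Finset.univ hJ)).sub
    ((hdiff.add hK).const_mul (1 / 2)) using 3 with u v
  ring
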